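/- Let Φ = {4321, 34512, 45123, 35412, 43512, 45132, 45213, 53412, 45312, 45231}. If a permutation w avoids every pattern in Φ, then rep(w) = [321;3412](w); otherwise, rep(w) < [321;3412](w). In particular, rep(w) ≤ [321;3412](w) for every permutation w. -/

import Mathlib

/-!
Common framework.  Permutations of `{1, …, m}` are modelled as `Equiv.Perm (Fin m)`
with 0-based positions and values.  The simple reflection `sr m i` (for
`0 ≤ i ≤ m - 2`, corresponding to the paper's `s_{i+1}`) swaps the values `i` and
`i + 1`.  Cut statistics `Mstat w k` / `mstat w k` (the paper's `M_{k+1}`/`m_{k+1}`)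
are respectively the maximum of the first `k + 1` entries and the minimum of the
remaining entries of the one-line notation of `w`.
-/

/-- The simple reflection swapping `i` and `i + 1` (0-based) in the symmetric group
on `Fin m`; the identity if out of range. -/
def sr (m i : ℕ) : Equiv.Perm (Fin m) :=
  if h : i + 1 < m then Equiv.swap ⟨i, Nat.lt_of_succ_lt h⟩ ⟨i + 1, h⟩ else 1

/-- `l` is a word in the simple reflections whose product is `w`. -/
def IsWord (m : ℕ) (l : List ℕ) (w : Equiv.Perm (Fin m)) : Prop :=
  (∀ i ∈ l, i + 1 < m) ∧ (l.map (sr m)).prod = w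

/-- The Coxeter length `ℓ(w)`: the minimal length of a word expressing `w`. -/
noncomputable def len {m : ℕ} (w : Equiv.Perm (Fin m)) : ℕ :=
  sInf {c | ∃ l : List ℕ, IsWord m l w ∧ l.length = c}

/-- `l` is a reduced decomposition of `w`. -/
def IsReducedWord {m : ℕ} (w : Equiv.Perm (Fin m)) (l : List ℕ) : Prop :=
  IsWord m l w ∧ l.length = len w

/-- The support of `w`: the letters appearing in some reduced decomposition. -/
noncomputable def supp {m : ℕ} (w : Equiv.Perm (Fin m)) : Set ℕ :=
  {i | ∃ l : List ℕ, IsReducedWord w l ∧ i ∈ l}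

/-- `rep w = ℓ(w) - |supp w|`, the number of repeated letters. -/
noncomputable def rep {m : ℕ} (w : Equiv.Perm (Fin m)) : ℕ :=
  len w - (supp w).ncard

/-- The value of `w` at the (0-based) position `i`, as a natural number. -/
def valAt {m : ℕ} (w : Equiv.Perm (Fin m)) (i : ℕ) : ℕ :=
  if h : i < m then (w ⟨i, h⟩ : ℕ) else 0

/-- The (0-based) position at which the value `v` occurs in `w`. -/
def posOf {m : ℕ} (w : Equiv.Perm (Fin m)) (v : ℕ) : ℕ :=
  if h : v < m then (w⁻¹ ⟨v, h⟩ : ℕ) else 0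

/-- `Mstat w k`: the maximum of the first `k + 1` entries of `w`. -/
noncomputable def Mstat {m : ℕ} (w : Equiv.Perm (Fin m)) (k : ℕ) : ℕ :=
  sSup {v | ∃ i : Fin m, (i : ℕ) ≤ k ∧ (w i : ℕ) = v}

/-- `mstat w k`: the minimum of the entries of `w` in positions `> k`. -/
noncomputable def mstat {m : ℕ} (w : Equiv.Perm (Fin m)) (k : ℕ) : ℕ :=
  sInf {v | ∃ i : Fin m, k < (i : ℕ) ∧ (w i : ℕ) = v}

/-- `wbar` is obtained from `w` by deleting the largest letter from the one-line
notation of `w` and sliding all subsequent letters one space to the left. -/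
def IsDeletion {n : ℕ} (w : Equiv.Perm (Fin (n + 1))) (wbar : Equiv.Perm (Fin n)) : Prop :=
  ∀ i : Fin n, (wbar i : ℕ) =
    if (i : ℕ) < posOf w n then valAt w (i : ℕ) else valAt w ((i : ℕ) + 1)

/-- `newrep w wbar`: the letters `k` with `s_k ∈ supp(wbar)` and `w⁻¹(top) ≤ k`. -/
noncomputable def newrep {n : ℕ} (w : Equiv.Perm (Fin (n + 1))) (wbar : Equiv.Perm (Fin n)) :
    Set ℕ :=
  {k | k ∈ supp wbar ∧ posOf w n ≤ k}

/-- An occurrence of the pattern `p` in `w`, recorded by its set `S` of values: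
there are positions `f 0 < f 1 < ⋯` whose values are in the same relative order
as `p`, and `S` is the corresponding set of values. -/
def IsOccSet {m c : ℕ} (p : Fin c → ℕ) (w : Equiv.Perm (Fin m)) (S : Finset ℕ) : Prop :=
  ∃ f : Fin c → Fin m, StrictMono f ∧ (∀ a b : Fin c, p a < p b ↔ w (f a) < w (f b)) ∧
    S = Finset.image (fun a => (w (f a) : ℕ)) Finset.univ

/-- An `N`-occurrence (here `N = n`, the largest 0-based value): an occurrence
whose largest letter is the largest value of `w`. -/
def IsTopOccSet {n c : ℕ} (p : Fin c → ℕ) (w : Equiv.Perm (Fin (n + 1))) (S : Finset ℕ) : Prop :=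
  IsOccSet p w S ∧ n ∈ S

/-- The number of occurrences of the pattern `p` in `w`. -/
noncomputable def occCount {m c : ℕ} (p : Fin c → ℕ) (w : Equiv.Perm (Fin m)) : ℕ :=
  Set.ncard {S : Finset ℕ | IsOccSet p w S}

/-- The number of `N`-occurrences of the pattern `p` in `w`. -/
noncomputable def topOccCount {n c : ℕ} (p : Fin c → ℕ) (w : Equiv.Perm (Fin (n + 1))) : ℕ :=
  Set.ncard {S : Finset ℕ | IsTopOccSet p w S}

def p321 : Fin 3 → ℕ := ![3, 2, 1]
def p3412 : Fin 4 → ℕ := ![3, 4, 1, 2]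
def p4321 : Fin 4 → ℕ := ![4, 3, 2, 1]
def p34512 : Fin 5 → ℕ := ![3, 4, 5, 1, 2]
def p45123 : Fin 5 → ℕ := ![4, 5, 1, 2, 3]
def p35412 : Fin 5 → ℕ := ![3, 5, 4, 1, 2]
def p43512 : Fin 5 → ℕ := ![4, 3, 5, 1, 2]
def p45132 : Fin 5 → ℕ := ![4, 5, 1, 3, 2]
def p45213 : Fin 5 → ℕ := ![4, 5, 2, 1, 3]
def p53412 : Fin 5 → ℕ := ![5, 3, 4, 1, 2]
def p45312 : Fin 5 → ℕ := ![4, 5, 3, 1, 2]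
def p45231 : Fin 5 → ℕ := ![4, 5, 2, 3, 1]

/-- The pattern `𝔭_k(w)` of Definition 4.4, recorded as its set of values:
(I) if `w⁻¹(top)` is left of `w⁻¹(M_k)`, the 321-occurrence `{top, M_k, m_k}`;
(II) else if `wbar(k) > m_k`, the 321-occurrence `{top, wbar(k), m_k}`;
(III) otherwise the 3412-occurrence `{M_k, top, wbar(k), m_k}`. -/
noncomputable def pocc {n : ℕ} (w : Equiv.Perm (Fin (n + 1))) (wbar : Equiv.Perm (Fin n))
    (k : ℕ) : Finset ℕ :=
  if posOf w n < posOf w (Mstat wbar k) then {n, Mstat wbar k, mstat wbar k}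
  else if mstat wbar k < valAt wbar k then {n, valAt wbar k, mstat wbar k}
  else {Mstat wbar k, n, valAt wbar k, mstat wbar k}

/-- `w` avoids every pattern in
`Φ = {4321, 34512, 45123, 35412, 43512, 45132, 45213, 53412, 45312, 45231}`. -/
def AvoidsPhi {m : ℕ} (w : Equiv.Perm (Fin m)) : Prop :=
  (¬ ∃ S : Finset ℕ, IsOccSet p4321 w S) ∧ (¬ ∃ S : Finset ℕ, IsOccSet p34512 w S) ∧
  (¬ ∃ S : Finset ℕ, IsOccSet p45123 w S) ∧ (¬ ∃ S : Finset ℕ, IsOccSet p35412 w S) ∧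
  (¬ ∃ S : Finset ℕ, IsOccSet p43512 w S) ∧ (¬ ∃ S : Finset ℕ, IsOccSet p45132 w S) ∧
  (¬ ∃ S : Finset ℕ, IsOccSet p45213 w S) ∧ (¬ ∃ S : Finset ℕ, IsOccSet p53412 w S) ∧
  (¬ ∃ S : Finset ℕ, IsOccSet p45312 w S) ∧ (¬ ∃ S : Finset ℕ, IsOccSet p45231 w S)


/-- The inversions of a sequence in which the letter `a` stands at position `p a`,
recorded as pairs (smaller letter, larger letter). -/
def inversions {m : ℕ} (p : Fin m → Fin m) : Finset (Fin m × Fin m) :=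
  Finset.univ.filter fun x => x.1 < x.2 ∧ p x.2 < p x.1

theorem mem_inversions {m : ℕ} {p : Fin m → Fin m} {a b : Fin m} :
    (a, b) ∈ inversions p ↔ a < b ∧ p b < p a := by
  simp [inversions]

theorem swap_lt_swap {m : ℕ} {i j a b : Fin m} (hij : (j : ℕ) = i + 1) (hab : a < b)
    (hne : ¬ (a = i ∧ b = j)) : Equiv.swap i j a < Equiv.swap i j b := by
  simp only [Equiv.swap_apply_def]
  grind

theorem card_inversions_comp_swap {m : ℕ} (p : Fin m → Fin m) {i j : Fin m}
    (hij : (j : ℕ) = i + 1) (h : p i < p j) :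
    (inversions (p ∘ Equiv.swap i j)).card = (inversions p).card + 1 := by
  classical
  have hlt : i < j := by grind
  have key : inversions (p ∘ Equiv.swap i j) =
      insert (i, j) ((inversions p).map
        ((Equiv.swap i j).prodCongr (Equiv.swap i j)).toEmbedding) := by
    ext ⟨a, b⟩
    simp only [Finset.mem_insert, Finset.mem_map_equiv, Equiv.prodCongr_symm, Equiv.symm_swap,
      Equiv.prodCongr_apply, Prod.map_apply, mem_inversions, Function.comp_apply, Prod.mk.injEq]
    constructor
    · rintro ⟨hab, hp⟩
      by_cases hc : a = i ∧ b = j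
      · exact Or.inl hc
      · exact Or.inr ⟨swap_lt_swap hij hab hc, hp⟩
    · rintro (⟨rfl, rfl⟩ | ⟨hab, hp⟩)
      · simp [hlt, h]
      · refine ⟨?_, hp⟩
        have := swap_lt_swap hij hab (by rintro ⟨h1, h2⟩; rw [h1, h2] at hp; exact absurd hp h.not_gt)
        simpa using this
  rw [key, Finset.card_insert_of_notMem, Finset.card_map]
  simp only [Finset.mem_map_equiv, Equiv.prodCongr_symm, Equiv.symm_swap,
    Equiv.prodCongr_apply, Prod.map_apply, mem_inversions]
  simp [hlt.le]

theorem sr_of_lt {m i : ℕ} (h : i + 1 < m) :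
    sr m i = Equiv.swap ⟨i, Nat.lt_of_succ_lt h⟩ ⟨i + 1, h⟩ := dif_pos h

theorem coe_inv_sr_mul {m i : ℕ} (h : i + 1 < m) (w : Equiv.Perm (Fin m)) :
    ⇑(sr m i * w)⁻¹ = ⇑w⁻¹ ∘ Equiv.swap ⟨i, Nat.lt_of_succ_lt h⟩ ⟨i + 1, h⟩ := by
  rw [mul_inv_rev, Equiv.Perm.coe_mul, sr_of_lt h, Equiv.swap_inv]

theorem card_inversions_sr_mul_of_lt {m i : ℕ} (h : i + 1 < m) (w : Equiv.Perm (Fin m))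
    (hw : w⁻¹ ⟨i, Nat.lt_of_succ_lt h⟩ < w⁻¹ ⟨i + 1, h⟩) :
    (inversions ⇑(sr m i * w)⁻¹).card = (inversions ⇑w⁻¹).card + 1 := by
  rw [coe_inv_sr_mul h]
  exact card_inversions_comp_swap _ rfl hw

theorem sr_mul_sr_mul {m i : ℕ} (h : i + 1 < m) (w : Equiv.Perm (Fin m)) :
    sr m i * (sr m i * w) = w := by
  rw [← mul_assoc, sr_of_lt h, Equiv.swap_mul_self, one_mul]

theorem card_inversions_sr_mul_of_gt {m i : ℕ} (h : i + 1 < m) (w : Equiv.Perm (Fin m))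
    (hw : w⁻¹ ⟨i + 1, h⟩ < w⁻¹ ⟨i, Nat.lt_of_succ_lt h⟩) :
    (inversions ⇑(sr m i * w)⁻¹).card + 1 = (inversions ⇑w⁻¹).card := by
  have := card_inversions_sr_mul_of_lt h (sr m i * w) (by rw [coe_inv_sr_mul h]; simpa using hw)
  rw [sr_mul_sr_mul h] at this
  exact this.symm

theorem card_inversions_sr_mul_le {m i : ℕ} (h : i + 1 < m) (w : Equiv.Perm (Fin m)) :
    (inversions ⇑(sr m i * w)⁻¹).card ≤ (inversions ⇑w⁻¹).card + 1 := by
  rcases lt_trichotomy (w⁻¹ ⟨i, Nat.lt_of_succ_lt h⟩) (w⁻¹ ⟨i + 1, h⟩) with hw | hw | hw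
  · exact (card_inversions_sr_mul_of_lt h w hw).le
  · simp at hw
  · have := card_inversions_sr_mul_of_gt h w hw
    omega

theorem isWord_cons {m i : ℕ} {l : List ℕ} {w : Equiv.Perm (Fin m)} :
    IsWord m (i :: l) w ↔ i + 1 < m ∧ ∃ u, IsWord m l u ∧ w = sr m i * u := by
  simp only [IsWord, List.mem_cons, forall_eq_or_imp, List.map_cons, List.prod_cons]
  grind

theorem IsWord.card_inversions_le {m : ℕ} {l : List ℕ} {w : Equiv.Perm (Fin m)}
    (h : IsWord m l w) : (inversions ⇑w⁻¹).card ≤ l.length := by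
  induction l generalizing w with
  | nil =>
    obtain rfl : w = 1 := by simpa using h.2.symm
    simp only [inv_one, List.length_nil, Nat.le_zero, Finset.card_eq_zero]
    ext ⟨a, b⟩
    simp only [mem_inversions, Equiv.Perm.coe_one, id_eq, Finset.notMem_empty, iff_false]
    grind
  | cons i l ih =>
    obtain ⟨hi, u, hu, rfl⟩ := isWord_cons.1 h
    have := card_inversions_sr_mul_le hi u
    have := ih hu
    rw [List.length_cons]
    omega

theorem eq_one_of_forall_lt {m : ℕ} (w : Equiv.Perm (Fin m))
    (h : ∀ (i : ℕ) (hi : i + 1 < m), w⁻¹ ⟨i, Nat.lt_of_succ_lt hi⟩ < w⁻¹ ⟨i + 1, hi⟩) :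
    w = 1 := by
  cases m with
  | zero => exact Subsingleton.elim _ _
  | succ n =>
    have hmono : StrictMono ⇑w⁻¹ := Fin.strictMono_iff_lt_succ.2 fun i => h i (by omega)
    have hid : ⇑w⁻¹ = id := (hmono.range_inj strictMono_id).1 (by
      rw [w⁻¹.surjective.range_eq, Set.range_id])
    have : w⁻¹ = 1 := Equiv.ext fun x => congrFun hid x
    simpa using this

theorem exists_isWord {m : ℕ} (w : Equiv.Perm (Fin m)) :
    ∃ l, IsWord m l w ∧ l.length = (inversions ⇑w⁻¹).card := by
  induction hn : (inversions ⇑w⁻¹).card generalizing w with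
  | zero =>
    refine ⟨[], ⟨by simp, ?_⟩, rfl⟩
    refine (eq_one_of_forall_lt w fun i hi => ?_).symm
    by_contra hc
    rw [Finset.card_eq_zero] at hn
    have : ((⟨i, Nat.lt_of_succ_lt hi⟩, ⟨i + 1, hi⟩) : Fin m × Fin m) ∈ inversions ⇑w⁻¹ :=
      mem_inversions.2 ⟨by simp, lt_of_le_of_ne (not_lt.1 hc) (by simp)⟩
    rw [hn] at this
    exact absurd this (Finset.notMem_empty _)
  | succ n ih =>
    obtain ⟨i, hi, hlt⟩ : ∃ (i : ℕ) (hi : i + 1 < m),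
        w⁻¹ ⟨i + 1, hi⟩ < w⁻¹ ⟨i, Nat.lt_of_succ_lt hi⟩ := by
      by_contra! hc
      have := eq_one_of_forall_lt w fun i hi => lt_of_le_of_ne (hc i hi) (by simp)
      have h1 := IsWord.card_inversions_le (l := []) (w := w) ⟨by simp, by simp [this]⟩
      rw [hn, List.length_nil] at h1
      omega
    have := card_inversions_sr_mul_of_gt hi w hlt
    obtain ⟨l, hl, hlen⟩ := ih (sr m i * w) (by omega)
    exact ⟨i :: l, isWord_cons.2 ⟨hi, _, hl, (sr_mul_sr_mul hi w).symm⟩, by simp [hlen]⟩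

theorem len_eq_card_inversions {m : ℕ} (w : Equiv.Perm (Fin m)) :
    len w = (inversions ⇑w⁻¹).card := by
  obtain ⟨l, hl, hlen⟩ := exists_isWord w
  refine le_antisymm (Nat.sInf_le ⟨l, hl, hlen⟩) (le_csInf ⟨_, l, hl, rfl⟩ ?_)
  rintro _ ⟨l', hl', rfl⟩
  exact hl'.card_inversions_le

theorem IsReducedWord.exists_le_of_mem {m k : ℕ} {l : List ℕ} {w : Equiv.Perm (Fin m)}
    (h : IsReducedWord w l) (hk : k ∈ l) : ∃ b : Fin m, k < b ∧ (w⁻¹ b : ℕ) ≤ k := by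
  induction l generalizing w with
  | nil => simp at hk
  | cons i l ih =>
    obtain ⟨hw, hlen⟩ := h
    rw [len_eq_card_inversions, List.length_cons] at hlen
    obtain ⟨hi, u, hu, rfl⟩ := isWord_cons.1 hw
    have h1 := hu.card_inversions_le
    have h2 := card_inversions_sr_mul_le hi u
    have hred : IsReducedWord u l := ⟨hu, by rw [len_eq_card_inversions]; omega⟩
    have hlt : u⁻¹ ⟨i, Nat.lt_of_succ_lt hi⟩ < u⁻¹ ⟨i + 1, hi⟩ := by
      by_contra hc
      have := card_inversions_sr_mul_of_gt hi u (lt_of_le_of_ne (not_lt.1 hc) (by simp))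
      omega
    rw [coe_inv_sr_mul hi]
    by_cases hki : k = i
    · subst hki
      by_cases hu' : (u⁻¹ ⟨k, Nat.lt_of_succ_lt hi⟩ : ℕ) ≤ k
      · exact ⟨⟨k + 1, hi⟩, by simp, by simpa using hu'⟩
      · obtain ⟨b, hb, hub⟩ : ∃ b : Fin m, k < b ∧ (u⁻¹ b : ℕ) ≤ k := by
          by_contra! hc
          have hmaps : Set.MapsTo ⇑u⁻¹ (Set.Ici ⟨k, Nat.lt_of_succ_lt hi⟩)
              (Set.Ioi ⟨k, Nat.lt_of_succ_lt hi⟩) := by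
            intro b hb
            rcases (Set.mem_Ici.1 hb).eq_or_lt with rfl | hb
            · exact Fin.lt_def.2 (not_le.1 hu')
            · exact Fin.lt_def.2 (hc b hb)
          have := Finset.card_le_card_of_injOn (s := Finset.Ici ⟨k, Nat.lt_of_succ_lt hi⟩)
            (t := Finset.Ioi ⟨k, Nat.lt_of_succ_lt hi⟩) ⇑u⁻¹ (by simpa using hmaps)
            (u⁻¹.injective.injOn)
          simp at this
          omega
        refine ⟨b, hb, ?_⟩
        have hne : b ≠ ⟨k + 1, hi⟩ := by
          rintro rfl
          rw [Fin.lt_def] at hlt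
          omega
        rw [Function.comp_apply, Equiv.swap_apply_of_ne_of_ne (by grind) hne]
        exact hub
    · obtain ⟨b, hb, hub⟩ := ih hred (by grind)
      refine ⟨Equiv.swap ⟨i, Nat.lt_of_succ_lt hi⟩ ⟨i + 1, hi⟩ b, ?_, by simpa using hub⟩
      rw [Equiv.swap_apply_def]
      split_ifs <;> grind

theorem IsWord.inv_le_iff_of_notMem {m k : ℕ} {l : List ℕ} {w : Equiv.Perm (Fin m)}
    (h : IsWord m l w) (hk : k ∉ l) (a : Fin m) : (w⁻¹ a : ℕ) ≤ k ↔ (a : ℕ) ≤ k := by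
  induction l generalizing w a with
  | nil =>
    obtain rfl : w = 1 := by simpa using h.2.symm
    simp
  | cons i l ih =>
    obtain ⟨hi, u, hu, rfl⟩ := isWord_cons.1 h
    rw [coe_inv_sr_mul hi, Function.comp_apply, ih hu (by grind), Equiv.swap_apply_def]
    split_ifs <;> grind

/-- Among the letters `< v`, some inversion has its larger letter weakly left of position `q`
and its smaller letter strictly right of it. -/
def IsCrossed {m : ℕ} (p : Fin m → Fin m) (v q : ℕ) : Prop :=
  ∃ a b : Fin m, a < b ∧ (b : ℕ) < v ∧ (p b : ℕ) ≤ q ∧ q < p a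

theorem mem_supp_iff_isCrossed {m : ℕ} (w : Equiv.Perm (Fin m)) (k : ℕ) :
    k ∈ supp w ↔ IsCrossed ⇑w⁻¹ m k := by
  constructor
  · rintro ⟨l, hl, hk⟩
    obtain ⟨b, hb, hwb⟩ := hl.exists_le_of_mem hk
    obtain ⟨a, ha, hwa⟩ : ∃ a : Fin m, (a : ℕ) ≤ k ∧ k < w⁻¹ a := by
      by_contra! hc
      have hkm : k < m := hb.trans b.2
      have := Finset.card_le_card_of_injOn (s := insert b (Finset.Iic ⟨k, hkm⟩))
        (t := Finset.Iic ⟨k, hkm⟩) ⇑w⁻¹ (by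
          intro x hx
          simp only [Finset.coe_insert, Set.mem_insert_iff, Finset.coe_Iic, Set.mem_Iic] at hx ⊢
          rcases hx with rfl | hx
          · exact hwb
          · exact hc x hx) (w⁻¹.injective.injOn)
      rw [Finset.card_insert_of_notMem (by simpa [Fin.lt_def] using hb)] at this
      omega
    exact ⟨a, b, Fin.lt_def.2 (by omega), b.2, hwb, hwa⟩
  · rintro ⟨a, b, hab, -, hb, ha⟩
    obtain ⟨l, hl, hlen⟩ := exists_isWord w
    refine ⟨l, ⟨hl, by rw [hlen, len_eq_card_inversions]⟩, ?_⟩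
    by_contra hk
    have h1 := hl.inv_le_iff_of_notMem hk a
    have h2 := hl.inv_le_iff_of_notMem hk b
    rw [Fin.lt_def] at hab
    omega

theorem IsCrossed.mono {m : ℕ} {p : Fin m → Fin m} {v v' q : ℕ} (hv : v ≤ v')
    (h : IsCrossed p v q) : IsCrossed p v' q := by
  obtain ⟨a, b, hab, hb, h⟩ := h
  exact ⟨a, b, hab, hb.trans_le hv, h⟩

open Classical in
/-- The letters `x < v` such that some inversion among the letters `< v` crosses the gap
immediately to the right of `x`. -/
noncomputable def crossedLetters {m : ℕ} (p : Fin m → Fin m) (v : ℕ) : Finset (Fin m) :=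
  Finset.univ.filter fun x => (x : ℕ) < v ∧ IsCrossed p v (p x)

open Classical in
/-- The inversions `(x, v)` such that the gap to the right of `x` is already crossed by an
inversion among the letters `< v`. -/
noncomputable def repeats {m : ℕ} (p : Fin m → Fin m) : Finset (Fin m × Fin m) :=
  (inversions p).filter fun z => IsCrossed p z.2 (p z.1)

theorem mem_crossedLetters {m : ℕ} {p : Fin m → Fin m} {v : ℕ} {x : Fin m} :
    x ∈ crossedLetters p v ↔ (x : ℕ) < v ∧ IsCrossed p v (p x) := by
  simp [crossedLetters]

theorem mem_repeats {m : ℕ} {p : Fin m → Fin m} {x v : Fin m} :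
    (x, v) ∈ repeats p ↔ x < v ∧ p v < p x ∧ IsCrossed p v (p x) := by
  simp [repeats, mem_inversions, and_assoc]

theorem isCrossed_succ_iff {m : ℕ} {p : Fin m → Fin m} {v : Fin m} {q : ℕ} :
    IsCrossed p (v + 1) q ↔
      IsCrossed p v q ∨ ((p v : ℕ) ≤ q ∧ ∃ y : Fin m, y < v ∧ q < p y) := by
  constructor
  · rintro ⟨a, b, hab, hb, hq, hq'⟩
    rcases (Nat.lt_succ_iff.1 hb).eq_or_lt with h | h
    · obtain rfl : b = v := Fin.ext h
      exact Or.inr ⟨hq, a, hab, hq'⟩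
    · exact Or.inl ⟨a, b, hab, h, hq, hq'⟩
  · rintro (h | ⟨h, y, hy, hq⟩)
    · exact h.mono (Nat.le_succ _)
    · exact ⟨y, v, hy, Nat.lt_succ_self _, h, hq⟩

open Classical in
theorem card_crossedLetters_succ {m : ℕ} {p : Fin m → Fin m} (hp : Function.Injective p)
    (v : Fin m) :
    (crossedLetters p (v + 1)).card = (crossedLetters p v).card +
      (Finset.univ.filter fun x => x < v ∧ p v < p x ∧ ¬ IsCrossed p v (p x)).card := by
  set X := Finset.univ.filter fun x => x < v ∧ p v < p x ∧ ¬ IsCrossed p v (p x) with hX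
  have memX : ∀ x, x ∈ X ↔ x < v ∧ p v < p x ∧ ¬ IsCrossed p v (p x) := by simp [hX]
  by_cases hne : ∃ y, y < v ∧ p v < p y
  · obtain ⟨z, hz, hmax⟩ := Finset.exists_max_image
      (Finset.univ.filter fun y => y < v ∧ p v < p y) p (by
        obtain ⟨y, hy⟩ := hne
        exact ⟨y, by simpa using hy⟩)
    simp only [Finset.mem_filter, Finset.mem_univ, true_and, and_imp] at hz hmax
    have hlast : ∀ y, y < v → p y ≤ p z := fun y hy => by
      by_cases h : p v < p y
      · exact hmax y hy h
      · exact (not_lt.1 h).trans hz.2.le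
    have hzc : ¬ IsCrossed p v (p z) := by
      rintro ⟨a, b, hab, hb, -, ha⟩
      exact absurd (Fin.lt_def.2 ha) (hlast a (hab.trans (Fin.lt_def.2 hb))).not_gt
    have hzX : z ∈ X := (memX z).2 ⟨hz.1, hz.2, hzc⟩
    have hvX : v ∉ X.erase z := by simp [memX]
    have key : crossedLetters p (v + 1) = crossedLetters p v ∪ insert v (X.erase z) := by
      ext x
      simp only [Finset.mem_union, mem_crossedLetters, Finset.mem_insert, Finset.mem_erase, memX,
        isCrossed_succ_iff]
      constructor
      · rintro ⟨hx, h⟩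
        rcases (Nat.lt_succ_iff.1 hx).eq_or_lt with hxv | hxv
        · exact Or.inr (Or.inl (Fin.ext hxv))
        · by_cases hc : IsCrossed p v (p x)
          · exact Or.inl ⟨hxv, hc⟩
          · obtain ⟨h1, y, hy, hxy⟩ := h.resolve_left hc
            refine Or.inr (Or.inr ⟨?_, hxv, ?_, hc⟩)
            · rintro rfl
              exact absurd (Fin.lt_def.2 hxy) (hlast y hy).not_gt
            · refine lt_of_le_of_ne h1 fun he => ?_
              rw [hp he] at hxv
              exact lt_irrefl _ hxv
      · rintro (⟨hx, hc⟩ | rfl | ⟨hxz, hxv, hx, hc⟩)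
        · exact ⟨hx.trans (Nat.lt_succ_self _), Or.inl hc⟩
        · exact ⟨Nat.lt_succ_self _, Or.inr ⟨le_rfl, z, hz.1, hz.2⟩⟩
        · exact ⟨Nat.lt_succ_of_lt hxv, Or.inr ⟨hx.le, z, hz.1,
            lt_of_le_of_ne (hlast x hxv) fun h => hxz (hp (Fin.ext h))⟩⟩
    rw [key, Finset.card_union_of_disjoint, Finset.card_insert_of_notMem hvX,
      Finset.card_erase_add_one hzX]
    rw [Finset.disjoint_left]
    intro x hx hx'
    rw [mem_crossedLetters] at hx
    rw [Finset.mem_insert, Finset.mem_erase, memX] at hx'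
    rcases hx' with rfl | hx'
    · exact lt_irrefl _ hx.1
    · exact hx'.2.2.2 hx.2
  · push Not at hne
    have hX0 : X = ∅ := Finset.eq_empty_of_forall_notMem fun x hx =>
      absurd ((memX x).1 hx).2.1 (hne x ((memX x).1 hx).1).not_gt
    rw [hX0, Finset.card_empty, add_zero]
    congr 1
    ext x
    simp only [mem_crossedLetters, isCrossed_succ_iff]
    constructor
    · rintro ⟨hx, h | ⟨h, y, hy, hxy⟩⟩
      · refine ⟨lt_of_le_of_ne (Nat.lt_succ_iff.1 hx) fun he => ?_, h⟩
        obtain rfl : x = v := Fin.ext he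
        obtain ⟨a, b, hab, hb, -, ha⟩ := h
        exact absurd (Fin.lt_def.2 ha) (hne a (hab.trans (Fin.lt_def.2 hb))).not_gt
      · exact absurd (lt_of_le_of_lt h hxy) (hne y hy).not_gt
    · rintro ⟨hx, h⟩
      exact ⟨hx.trans (Nat.lt_succ_self _), Or.inl h⟩

open Classical in
theorem card_crossedLetters {m : ℕ} {p : Fin m → Fin m} (hp : Function.Injective p)
    {v : ℕ} (hv : v ≤ m) :
    (crossedLetters p v).card =
      ((inversions p).filter fun z => (z.2 : ℕ) < v ∧ ¬ IsCrossed p z.2 (p z.1)).card := by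
  induction v with
  | zero => simp [crossedLetters]
  | succ v ih =>
    rw [card_crossedLetters_succ hp ⟨v, hv⟩, ih (by omega)]
    have : ((inversions p).filter fun z => (z.2 : ℕ) < v + 1 ∧ ¬ IsCrossed p z.2 (p z.1)) =
        ((inversions p).filter fun z => (z.2 : ℕ) < v ∧ ¬ IsCrossed p z.2 (p z.1)) ∪
        (Finset.univ.filter fun x : Fin m =>
          x < ⟨v, hv⟩ ∧ p ⟨v, hv⟩ < p x ∧ ¬ IsCrossed p v (p x)).image
          fun x => (x, ⟨v, hv⟩) := by
      ext ⟨x, y⟩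
      simp only [Finset.mem_filter, mem_inversions, Finset.mem_union, Finset.mem_image,
        Finset.mem_univ, true_and, Prod.mk.injEq]
      constructor
      · rintro ⟨h, h1, h2⟩
        rcases (Nat.lt_succ_iff.1 h1).eq_or_lt with hy | hy
        · obtain rfl : y = ⟨v, hv⟩ := Fin.ext hy
          exact Or.inr ⟨x, ⟨h.1, h.2, h2⟩, rfl, rfl⟩
        · exact Or.inl ⟨h, hy, h2⟩
      · rintro (⟨h, h1, h2⟩ | ⟨x, h, rfl, rfl⟩)
        · exact ⟨h, h1.trans (Nat.lt_succ_self _), h2⟩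
        · exact ⟨⟨h.1, h.2.1⟩, Nat.lt_succ_self _, h.2.2⟩
    rw [this, Finset.card_union_of_disjoint, Finset.card_image_of_injective]
    · intro x y h
      simpa using h
    · rw [Finset.disjoint_left]
      rintro ⟨x, y⟩ h h'
      simp only [Finset.mem_filter, Finset.mem_image, Prod.mk.injEq] at h h'
      obtain ⟨-, -, -, rfl⟩ := h'
      exact lt_irrefl _ h.2.1

theorem ncard_supp {m : ℕ} (w : Equiv.Perm (Fin m)) :
    (supp w).ncard = (crossedLetters ⇑w⁻¹ m).card := by
  have : supp w = (fun x => (w⁻¹ x : ℕ)) '' (crossedLetters ⇑w⁻¹ m : Set (Fin m)) := by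
    ext k
    simp only [mem_supp_iff_isCrossed, Set.mem_image, Finset.mem_coe, mem_crossedLetters]
    constructor
    · intro h
      have hk : k < m := by
        obtain ⟨a, -, -, -, -, ha⟩ := h
        exact ha.trans (w⁻¹ a).2
      exact ⟨w ⟨k, hk⟩, ⟨(w ⟨k, hk⟩).2, by simpa using h⟩, by simp⟩
    · rintro ⟨x, ⟨-, hx⟩, rfl⟩
      exact hx
  have hinj : Function.Injective fun x => (w⁻¹ x : ℕ) := Fin.val_injective.comp w⁻¹.injective
  rw [this, Set.ncard_image_of_injective _ hinj, Set.ncard_coe_finset]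

theorem rep_eq_card_repeats {m : ℕ} (w : Equiv.Perm (Fin m)) :
    rep w = (repeats ⇑w⁻¹).card := by
  classical
  rw [rep, len_eq_card_inversions, ncard_supp, card_crossedLetters w⁻¹.injective le_rfl]
  have h := Finset.card_filter_add_card_filter_not (s := inversions ⇑w⁻¹)
    fun z => IsCrossed ⇑w⁻¹ z.2 (w⁻¹ z.1)
  rw [repeats, ← h]
  simp only [Fin.is_lt, true_and]
  omega

open Classical in
/-- The occurrences of the pattern `pat` in the sequence in which the letter `a` stands at
position `p a`, recorded as the sequences of their letters. -/
noncomputable def occurrences {m c : ℕ} (pat : Fin c → ℕ) (p : Fin m → Fin m) :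
    Finset (Fin c → Fin m) :=
  Finset.univ.filter fun g => StrictMono (p ∘ g) ∧ ∀ a b, pat a < pat b ↔ g a < g b

theorem mem_occurrences {m c : ℕ} {pat : Fin c → ℕ} {p : Fin m → Fin m} {g : Fin c → Fin m} :
    g ∈ occurrences pat p ↔ StrictMono (p ∘ g) ∧ ∀ a b, pat a < pat b ↔ g a < g b := by
  simp [occurrences]

theorem isOccSet_iff {m c : ℕ} (pat : Fin c → ℕ) (w : Equiv.Perm (Fin m)) (S : Finset ℕ) :
    IsOccSet pat w S ↔ ∃ g ∈ occurrences pat ⇑w⁻¹,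
      Finset.univ.image (fun a => (g a : ℕ)) = S := by
  constructor
  · rintro ⟨f, hf, hpat, rfl⟩
    refine ⟨w ∘ f, mem_occurrences.2 ⟨?_, hpat⟩, rfl⟩
    convert hf
    ext
    simp
  · rintro ⟨g, hg, rfl⟩
    rw [mem_occurrences] at hg
    exact ⟨fun i => w⁻¹ (g i), hg.1, by simpa using hg.2, by simp⟩

theorem occCount_eq_card {m c : ℕ} (pat : Fin c → ℕ) (w : Equiv.Perm (Fin m)) :
    occCount pat w = (occurrences pat ⇑w⁻¹).card := by
  have : {S : Finset ℕ | IsOccSet pat w S} =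
      (fun g : Fin c → Fin m => Finset.univ.image fun a => (g a : ℕ)) ''
        (occurrences pat ⇑w⁻¹ : Set (Fin c → Fin m)) := by
    ext S
    simp [isOccSet_iff]
  rw [occCount, this, Set.InjOn.ncard_image, Set.ncard_coe_finset]
  intro g hg g' hg' h
  rw [Finset.mem_coe, mem_occurrences] at hg hg'
  have hr : Set.range g = Set.range g' := by
    ext x
    have := Finset.ext_iff.1 h x
    simpa [Fin.val_inj] using this
  have := (hg.1.range_inj hg'.1).1 (by rw [Set.range_comp, Set.range_comp, hr])
  exact w⁻¹.injective.comp_left this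

theorem forall_not_isOccSet_iff {m c : ℕ} {pat : Fin c → ℕ} {w : Equiv.Perm (Fin m)} :
    (¬ ∃ S, IsOccSet pat w S) ↔ ∀ g, g ∉ occurrences pat ⇑w⁻¹ := by
  simp only [isOccSet_iff]
  grind

/-- If `e` lists the positions of a pattern by increasing letters, then the order
isomorphism condition on occurrences is a chain of inequalities. -/
theorem mem_occurrences_iff_strictMono {m c : ℕ} {pat : Fin c → ℕ} {p : Fin m → Fin m}
    {g : Fin c → Fin m} (e : Fin c → Fin c) (he : Function.Surjective e)
    (hpat : StrictMono (pat ∘ e)) :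
    g ∈ occurrences pat p ↔ StrictMono (p ∘ g) ∧ StrictMono (g ∘ e) := by
  rw [mem_occurrences]
  refine and_congr_right fun _ => ⟨fun h a b hab => (h _ _).1 (hpat hab), fun h a b => ?_⟩
  obtain ⟨a, rfl⟩ := he a
  obtain ⟨b, rfl⟩ := he b
  exact hpat.lt_iff_lt.trans h.lt_iff_lt.symm

theorem strictMono_fin_three {α : Type*} [Preorder α] {f : Fin 3 → α} :
    StrictMono f ↔ f 0 < f 1 ∧ f 1 < f 2 := by
  simp [Fin.strictMono_iff_lt_succ, Fin.forall_fin_succ]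

theorem strictMono_fin_four {α : Type*} [Preorder α] {f : Fin 4 → α} :
    StrictMono f ↔ f 0 < f 1 ∧ f 1 < f 2 ∧ f 2 < f 3 := by
  simp [Fin.strictMono_iff_lt_succ, Fin.forall_fin_succ]

theorem strictMono_fin_five {α : Type*} [Preorder α] {f : Fin 5 → α} :
    StrictMono f ↔ f 0 < f 1 ∧ f 1 < f 2 ∧ f 2 < f 3 ∧ f 3 < f 4 := by
  simp [Fin.strictMono_iff_lt_succ, Fin.forall_fin_succ]

theorem mem_occurrences_321 {m : ℕ} {p : Fin m → Fin m} {g : Fin 3 → Fin m} :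
    g ∈ occurrences p321 p ↔
      (p (g 0) < p (g 1) ∧ p (g 1) < p (g 2)) ∧ g 2 < g 1 ∧ g 1 < g 0 := by
  rw [mem_occurrences_iff_strictMono ![2, 1, 0] (by decide) (by decide)]
  simp [strictMono_fin_three]

theorem mem_occurrences_3412 {m : ℕ} {p : Fin m → Fin m} {g : Fin 4 → Fin m} :
    g ∈ occurrences p3412 p ↔
      (p (g 0) < p (g 1) ∧ p (g 1) < p (g 2) ∧ p (g 2) < p (g 3)) ∧
        g 2 < g 3 ∧ g 3 < g 0 ∧ g 0 < g 1 := by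
  rw [mem_occurrences_iff_strictMono ![2, 3, 0, 1] (by decide) (by decide)]
  simp [strictMono_fin_four]

theorem mem_occurrences_4321 {m : ℕ} {p : Fin m → Fin m} {g : Fin 4 → Fin m} :
    g ∈ occurrences p4321 p ↔
      (p (g 0) < p (g 1) ∧ p (g 1) < p (g 2) ∧ p (g 2) < p (g 3)) ∧
        g 3 < g 2 ∧ g 2 < g 1 ∧ g 1 < g 0 := by
  rw [mem_occurrences_iff_strictMono ![3, 2, 1, 0] (by decide) (by decide)]
  simp [strictMono_fin_four]

theorem mem_occurrences_34512 {m : ℕ} {p : Fin m → Fin m} {g : Fin 5 → Fin m} :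
    g ∈ occurrences p34512 p ↔
      (p (g 0) < p (g 1) ∧ p (g 1) < p (g 2) ∧ p (g 2) < p (g 3) ∧ p (g 3) < p (g 4)) ∧
        g 3 < g 4 ∧ g 4 < g 0 ∧ g 0 < g 1 ∧ g 1 < g 2 := by
  rw [mem_occurrences_iff_strictMono ![3, 4, 0, 1, 2] (by decide) (by decide)]
  simp [strictMono_fin_five]

theorem mem_occurrences_45123 {m : ℕ} {p : Fin m → Fin m} {g : Fin 5 → Fin m} :
    g ∈ occurrences p45123 p ↔
      (p (g 0) < p (g 1) ∧ p (g 1) < p (g 2) ∧ p (g 2) < p (g 3) ∧ p (g 3) < p (g 4)) ∧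
        g 2 < g 3 ∧ g 3 < g 4 ∧ g 4 < g 0 ∧ g 0 < g 1 := by
  rw [mem_occurrences_iff_strictMono ![2, 3, 4, 0, 1] (by decide) (by decide)]
  simp [strictMono_fin_five]

theorem mem_occurrences_35412 {m : ℕ} {p : Fin m → Fin m} {g : Fin 5 → Fin m} :
    g ∈ occurrences p35412 p ↔
      (p (g 0) < p (g 1) ∧ p (g 1) < p (g 2) ∧ p (g 2) < p (g 3) ∧ p (g 3) < p (g 4)) ∧
        g 3 < g 4 ∧ g 4 < g 0 ∧ g 0 < g 2 ∧ g 2 < g 1 := by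
  rw [mem_occurrences_iff_strictMono ![3, 4, 0, 2, 1] (by decide) (by decide)]
  simp [strictMono_fin_five]

theorem mem_occurrences_43512 {m : ℕ} {p : Fin m → Fin m} {g : Fin 5 → Fin m} :
    g ∈ occurrences p43512 p ↔
      (p (g 0) < p (g 1) ∧ p (g 1) < p (g 2) ∧ p (g 2) < p (g 3) ∧ p (g 3) < p (g 4)) ∧
        g 3 < g 4 ∧ g 4 < g 1 ∧ g 1 < g 0 ∧ g 0 < g 2 := by
  rw [mem_occurrences_iff_strictMono ![3, 4, 1, 0, 2] (by decide) (by decide)]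
  simp [strictMono_fin_five]

theorem mem_occurrences_45132 {m : ℕ} {p : Fin m → Fin m} {g : Fin 5 → Fin m} :
    g ∈ occurrences p45132 p ↔
      (p (g 0) < p (g 1) ∧ p (g 1) < p (g 2) ∧ p (g 2) < p (g 3) ∧ p (g 3) < p (g 4)) ∧
        g 2 < g 4 ∧ g 4 < g 3 ∧ g 3 < g 0 ∧ g 0 < g 1 := by
  rw [mem_occurrences_iff_strictMono ![2, 4, 3, 0, 1] (by decide) (by decide)]
  simp [strictMono_fin_five]

theorem mem_occurrences_45213 {m : ℕ} {p : Fin m → Fin m} {g : Fin 5 → Fin m} :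
    g ∈ occurrences p45213 p ↔
      (p (g 0) < p (g 1) ∧ p (g 1) < p (g 2) ∧ p (g 2) < p (g 3) ∧ p (g 3) < p (g 4)) ∧
        g 3 < g 2 ∧ g 2 < g 4 ∧ g 4 < g 0 ∧ g 0 < g 1 := by
  rw [mem_occurrences_iff_strictMono ![3, 2, 4, 0, 1] (by decide) (by decide)]
  simp [strictMono_fin_five]

theorem mem_occurrences_53412 {m : ℕ} {p : Fin m → Fin m} {g : Fin 5 → Fin m} :
    g ∈ occurrences p53412 p ↔
      (p (g 0) < p (g 1) ∧ p (g 1) < p (g 2) ∧ p (g 2) < p (g 3) ∧ p (g 3) < p (g 4)) ∧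
        g 3 < g 4 ∧ g 4 < g 1 ∧ g 1 < g 2 ∧ g 2 < g 0 := by
  rw [mem_occurrences_iff_strictMono ![3, 4, 1, 2, 0] (by decide) (by decide)]
  simp [strictMono_fin_five]

theorem mem_occurrences_45312 {m : ℕ} {p : Fin m → Fin m} {g : Fin 5 → Fin m} :
    g ∈ occurrences p45312 p ↔
      (p (g 0) < p (g 1) ∧ p (g 1) < p (g 2) ∧ p (g 2) < p (g 3) ∧ p (g 3) < p (g 4)) ∧
        g 3 < g 4 ∧ g 4 < g 2 ∧ g 2 < g 0 ∧ g 0 < g 1 := by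
  rw [mem_occurrences_iff_strictMono ![3, 4, 2, 0, 1] (by decide) (by decide)]
  simp [strictMono_fin_five]

theorem mem_occurrences_45231 {m : ℕ} {p : Fin m → Fin m} {g : Fin 5 → Fin m} :
    g ∈ occurrences p45231 p ↔
      (p (g 0) < p (g 1) ∧ p (g 1) < p (g 2) ∧ p (g 2) < p (g 3) ∧ p (g 3) < p (g 4)) ∧
        g 4 < g 2 ∧ g 2 < g 3 ∧ g 3 < g 0 ∧ g 0 < g 1 := by
  rw [mem_occurrences_iff_strictMono ![4, 2, 3, 0, 1] (by decide) (by decide)]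
  simp [strictMono_fin_five]

/-- Among the letters `< v`, the largest one weakly left of the position of `x` is `M`, and
the smallest one strictly right of it is `c`. -/
structure IsCut {m : ℕ} (p : Fin m → Fin m) (v x M c : Fin m) : Prop where
  lt_left : M < v
  pos_left : p M ≤ p x
  le_left : ∀ y, y < v → p y ≤ p x → y ≤ M
  lt_right : c < v
  pos_right : p x < p c
  le_right : ∀ y, y < v → p x < p y → c ≤ y

theorem exists_isCut {m : ℕ} {p : Fin m → Fin m} {v x y : Fin m} (hx : x < v) (hy : y < v)
    (hxy : p x < p y) : ∃ M c, IsCut p v x M c := by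
  obtain ⟨M, hM, hMmax⟩ := Finset.exists_max_image
    (Finset.univ.filter fun y => y < v ∧ p y ≤ p x) id ⟨x, by simpa using hx⟩
  obtain ⟨c, hc, hcmin⟩ := Finset.exists_min_image
    (Finset.univ.filter fun y => y < v ∧ p x < p y) id ⟨y, by simpa using ⟨hy, hxy⟩⟩
  simp only [Finset.mem_filter, Finset.mem_univ, true_and, and_imp, id_eq] at hM hMmax hc hcmin
  exact ⟨M, c, hM.1, hM.2, hMmax, hc.1, hc.2, hcmin⟩

theorem exists_isCut_of_mem_repeats {m : ℕ} {p : Fin m → Fin m} {x v : Fin m}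
    (h : (x, v) ∈ repeats p) : x < v ∧ p v < p x ∧ ∃ M c, IsCut p v x M c ∧ c < M := by
  obtain ⟨h1, h2, a, b, hab, hb, hbx, hxa⟩ := mem_repeats.1 h
  have hb' : b < v := hb
  obtain ⟨M, c, hcut⟩ := exists_isCut h1 (hab.trans hb') hxa
  exact ⟨h1, h2, M, c, hcut, ((hcut.le_right a (hab.trans hb') hxa).trans_lt hab).trans_le
    (hcut.le_left b hb' hbx)⟩

theorem IsCut.mem_repeats {m : ℕ} {p : Fin m → Fin m} {x v M c : Fin m}
    (h : IsCut p v x M c) (hcM : c < M) (hx : x < v) (hp : p v < p x) : (x, v) ∈ repeats p :=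
  _root_.mem_repeats.2 ⟨hx, hp, c, M, hcM, h.lt_left, h.pos_left, h.pos_right⟩

/-- The occurrence of 321 or 3412 attached to a repeat `(x, v)`. -/
def IsAttached {m : ℕ} (p : Fin m → Fin m) (z : Fin m × Fin m) :
    (Fin 3 → Fin m) ⊕ (Fin 4 → Fin m) → Prop
  | .inl g => g 0 = z.2 ∧ ∃ M, IsCut p z.2 z.1 M (g 2) ∧
      ((g 1 = z.1 ∧ g 2 < z.1) ∨ (z.1 < g 2 ∧ g 1 = M))
  | .inr g => g 1 = z.2 ∧ g 2 = z.1 ∧ IsCut p z.2 z.1 (g 0) (g 3)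

theorem exists_isAttached {m : ℕ} {p : Fin m → Fin m} (hp : Function.Injective p)
    {z : Fin m × Fin m} (hz : z ∈ repeats p) :
    ∃ o ∈ (occurrences p321 p).disjSum (occurrences p3412 p), IsAttached p z o := by
  obtain ⟨x, v⟩ := z
  obtain ⟨hx, hpx, M, c, hcut, hcM⟩ := exists_isCut_of_mem_repeats hz
  rcases lt_trichotomy c x with h | h | h
  · exact ⟨.inl ![v, x, c], by simp [mem_occurrences_321, hx, hpx, h, hcut.pos_right],
      rfl, M, hcut, .inl ⟨rfl, h⟩⟩
  · exact absurd hcut.pos_right (by simp [h])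
  · rcases lt_trichotomy (p v) (p M) with h' | h' | h'
    · exact ⟨.inl ![v, M, c], by
        simp [mem_occurrences_321, hcut.lt_left, h', hcM, hcut.pos_left.trans_lt hcut.pos_right],
        rfl, M, hcut, .inr ⟨h, rfl⟩⟩
    · exact absurd hcut.lt_left (by simp [hp h'])
    · exact ⟨.inr ![M, v, x, c], by
        simp [mem_occurrences_3412, hcut.lt_left, h', hcM, hpx, h, hcut.pos_right],
        rfl, rfl, hcut⟩

theorem IsAttached.left_unique {m : ℕ} {p : Fin m → Fin m} (hp : Function.Injective p)
    {z z' : Fin m × Fin m} {o : (Fin 3 → Fin m) ⊕ (Fin 4 → Fin m)} (hz : z ∈ repeats p)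
    (hz' : z' ∈ repeats p) (h : IsAttached p z o) (h' : IsAttached p z' o) : z = z' := by
  obtain ⟨x, v⟩ := z
  obtain ⟨x', v'⟩ := z'
  have hx := (mem_repeats.1 hz).1
  have hx' := (mem_repeats.1 hz').1
  obtain g | g := o
  · obtain ⟨h0, M, hcut, h⟩ := h
    obtain ⟨h0', M', hcut', h'⟩ := h'
    obtain rfl : v = v' := h0.symm.trans h0'
    have h1 := hcut.le_right x' hx'
    have h1' := hcut'.le_right x hx
    have h2 := hcut.pos_left
    have h2' := hcut'.pos_left
    have := @hp x x'
    grind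
  · obtain ⟨h1, h2, -⟩ := h
    obtain ⟨h1', h2', -⟩ := h'
    exact Prod.ext (h2.symm.trans h2') (h1.symm.trans h1')

theorem IsCut.unique {m : ℕ} {p : Fin m → Fin m} {v x M c M' c' : Fin m}
    (h : IsCut p v x M c) (h' : IsCut p v x M' c') : M = M' ∧ c = c' :=
  ⟨le_antisymm (h'.le_left M h.lt_left h.pos_left) (h.le_left M' h'.lt_left h'.pos_left),
    le_antisymm (h.le_right c' h'.lt_right h'.pos_right)
      (h'.le_right c h.lt_right h.pos_right)⟩

theorem IsAttached.right_unique {m : ℕ} {p : Fin m → Fin m} {z : Fin m × Fin m}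
    {o o' : (Fin 3 → Fin m) ⊕ (Fin 4 → Fin m)}
    (ho : o ∈ (occurrences p321 p).disjSum (occurrences p3412 p))
    (ho' : o' ∈ (occurrences p321 p).disjSum (occurrences p3412 p))
    (h : IsAttached p z o) (h' : IsAttached p z o') : o = o' := by
  obtain ⟨x, v⟩ := z
  have clash : ∀ (g : Fin 3 → Fin m) (g' : Fin 4 → Fin m), g ∈ occurrences p321 p →
      g' ∈ occurrences p3412 p → IsAttached p (x, v) (.inl g) →
      IsAttached p (x, v) (.inr g') → False := by
    intro g g' hg hg' ⟨h0, M, hcut, h⟩ ⟨h1, h2, hcut'⟩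
    obtain ⟨hM, hc⟩ := hcut.unique hcut'
    rw [mem_occurrences_321] at hg
    rw [mem_occurrences_3412] at hg'
    grind
  obtain g | g := o <;> obtain g' | g' := o' <;>
    simp only [Finset.inl_mem_disjSum, Finset.inr_mem_disjSum] at ho ho'
  · obtain ⟨h0, M, hcut, h⟩ := h
    obtain ⟨h0', M', hcut', h'⟩ := h'
    obtain ⟨hM, hc⟩ := hcut.unique hcut'
    congr 1
    ext i : 1
    fin_cases i
    · exact h0.trans h0'.symm
    · simp only [Fin.mk_one]
      grind
    · exact hc
  · exact (clash g g' ho ho' h h').elim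
  · exact (clash g' g ho' ho h' h).elim
  · obtain ⟨h1, h2, hcut⟩ := h
    obtain ⟨h1', h2', hcut'⟩ := h'
    obtain ⟨hM, hc⟩ := hcut.unique hcut'
    congr 1
    ext i : 1
    fin_cases i
    · exact hM
    · exact h1.trans h1'.symm
    · exact h2.trans h2'.symm
    · exact hc

theorem exists_mem_repeats_isAttached_inl {m : ℕ} {p : Fin m → Fin m}
    (hp : Function.Injective p) (h4321 : ∀ g, g ∉ occurrences p4321 p)
    (h53412 : ∀ g, g ∉ occurrences p53412 p) (h45312 : ∀ g, g ∉ occurrences p45312 p)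
    {g : Fin 3 → Fin m} (hg : g ∈ occurrences p321 p) :
    ∃ z ∈ repeats p, IsAttached p z (.inl g) := by
  obtain ⟨⟨hpv, hpb⟩, hcb, hbv⟩ := mem_occurrences_321.1 hg
  generalize hv : g 0 = v at *
  generalize hb : g 1 = b at *
  generalize hc : g 2 = c at *
  have no4321 : ∀ a b c d, ¬ ((p a < p b ∧ p b < p c ∧ p c < p d) ∧ d < c ∧ c < b ∧ b < a) :=
    fun a b c d h => h4321 ![a, b, c, d] (mem_occurrences_4321.2 h)
  have no53412 : ∀ a b c d e, ¬ ((p a < p b ∧ p b < p c ∧ p c < p d ∧ p d < p e) ∧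
      d < e ∧ e < b ∧ b < c ∧ c < a) :=
    fun a b c d e h => h53412 ![a, b, c, d, e] (mem_occurrences_53412.2 h)
  have no45312 : ∀ a b c d e, ¬ ((p a < p b ∧ p b < p c ∧ p c < p d ∧ p d < p e) ∧
      d < e ∧ e < c ∧ c < a ∧ a < b) :=
    fun a b c d e h => h45312 ![a, b, c, d, e] (mem_occurrences_45312.2 h)
  obtain ⟨M, n, hcut⟩ := exists_isCut hbv (hcb.trans hbv) hpb
  have hbM := hcut.le_left b hbv le_rfl
  rcases (hcut.le_right c (hcb.trans hbv) hpb).eq_or_lt with rfl | hnc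
  · exact ⟨(b, v), hcut.mem_repeats (hcb.trans_le hbM) hbv hpv, hv, M, hc ▸ hcut,
      .inl ⟨hb, by rwa [hc]⟩⟩
  · have hpn : p n < p c := by
      by_contra h
      have hne : p c ≠ p n := fun h => hnc.ne' (hp h)
      exact no4321 v b c n ⟨⟨hpv, hpb, lt_of_le_of_ne (not_lt.1 h) hne⟩, hnc, hcb, hbv⟩
    obtain ⟨y, hy, hymax⟩ := Finset.exists_max_image
      (Finset.univ.filter fun y => y < c ∧ p y < p c) p ⟨n, by simpa using ⟨hnc, hpn⟩⟩
    simp only [Finset.mem_filter, Finset.mem_univ, true_and, and_imp] at hy hymax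
    have hby : p b < p y := hcut.pos_right.trans_le (hymax n hnc hpn)
    obtain ⟨M', c', hcut'⟩ := exists_isCut (hy.1.trans (hcb.trans hbv)) (hcb.trans hbv) hy.2
    obtain rfl : c' = c := by
      by_contra hne
      have hlt : c' < c := lt_of_le_of_ne (hcut'.le_right c (hcb.trans hbv) hy.2) hne
      rcases lt_trichotomy (p c') (p c) with h | h | h
      · exact absurd hcut'.pos_right (hymax c' hlt h).not_gt
      · exact hne (hp h)
      · exact no4321 v b c c' ⟨⟨hpv, hpb, h⟩, hlt, hcb, hbv⟩
    obtain rfl : M' = b := by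
      by_contra hne
      have hbM' : b < M' := lt_of_le_of_ne (hcut'.le_left b hbv hby.le) (Ne.symm hne)
      have hMv := hcut'.lt_left
      have hMy : p M' < p y := lt_of_le_of_ne hcut'.pos_left
        fun h => (hy.1.trans (hcb.trans hbM')).ne' (hp h)
      rcases lt_trichotomy (p M') (p v) with h | h | h
      · exact no45312 M' v b y c' ⟨⟨h, hpv, hby, hy.2⟩, hy.1, hcb, hbM', hMv⟩
      · exact hMv.ne (hp h)
      · rcases lt_trichotomy (p M') (p b) with h' | h' | h'
        · exact no4321 v M' b c' ⟨⟨h, h', hpb⟩, hcb, hbM', hMv⟩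
        · exact hne (hp h')
        · exact no53412 v b M' y c' ⟨⟨hpv, h', hMy, hy.2⟩, hy.1, hcb, hbM', hMv⟩
    exact ⟨(y, v), hcut'.mem_repeats hcb (hy.1.trans (hcb.trans hbv)) (hpv.trans hby), hv, M',
      hc ▸ hcut', .inr ⟨by rw [hc]; exact hy.1, hb⟩⟩

theorem exists_mem_repeats_isAttached_inr {m : ℕ} {p : Fin m → Fin m}
    (hp : Function.Injective p) (h34512 : ∀ g, g ∉ occurrences p34512 p)
    (h45123 : ∀ g, g ∉ occurrences p45123 p) (h35412 : ∀ g, g ∉ occurrences p35412 p)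
    (h43512 : ∀ g, g ∉ occurrences p43512 p) (h45132 : ∀ g, g ∉ occurrences p45132 p)
    (h45213 : ∀ g, g ∉ occurrences p45213 p) (h45231 : ∀ g, g ∉ occurrences p45231 p)
    {g : Fin 4 → Fin m} (hg : g ∈ occurrences p3412 p) :
    ∃ z ∈ repeats p, IsAttached p z (.inr g) := by
  obtain ⟨⟨hMv, hvx, hxc⟩, hlt, hcM, hM⟩ := mem_occurrences_3412.1 hg
  generalize eM : g 0 = M at *
  generalize ev : g 1 = v at *
  generalize ex : g 2 = x at *
  generalize ec : g 3 = c at *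
  have hcv := hcM.trans hM
  obtain ⟨M', c', hcut⟩ := exists_isCut (hlt.trans hcv) hcv hxc
  obtain rfl : M' = M := by
    by_contra hne
    have hlt' : M < M' := lt_of_le_of_ne (hcut.le_left M hM (hMv.trans hvx).le) (Ne.symm hne)
    have hMv' := hcut.lt_left
    have hMx : p M' < p x := lt_of_le_of_ne hcut.pos_left
      fun h => (hlt.trans (hcM.trans hlt')).ne' (hp h)
    rcases lt_trichotomy (p M') (p M) with h | h | h
    · exact h43512 ![M', M, v, x, c] (mem_occurrences_43512.2
        ⟨⟨h, hMv, hvx, hxc⟩, hlt, hcM, hlt', hMv'⟩)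
    · exact hne (hp h)
    · rcases lt_trichotomy (p M') (p v) with h' | h' | h'
      · exact h34512 ![M, M', v, x, c] (mem_occurrences_34512.2
          ⟨⟨h, h', hvx, hxc⟩, hlt, hcM, hlt', hMv'⟩)
      · exact hMv'.ne (hp h')
      · exact h35412 ![M, v, M', x, c] (mem_occurrences_35412.2
          ⟨⟨hMv, h', hMx, hxc⟩, hlt, hcM, hlt', hMv'⟩)
  obtain rfl : c' = c := by
    by_contra hne
    have hlt' : c' < c := lt_of_le_of_ne (hcut.le_right c hcv hxc) hne
    have hxc' := hcut.pos_right
    rcases lt_trichotomy c' x with h | h | h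
    · rcases lt_trichotomy (p c') (p c) with h' | h' | h'
      · exact h45213 ![M', v, x, c', c] (mem_occurrences_45213.2
          ⟨⟨hMv, hvx, hxc', h'⟩, h, hlt, hcM, hM⟩)
      · exact hne (hp h')
      · exact h45231 ![M', v, x, c, c'] (mem_occurrences_45231.2
          ⟨⟨hMv, hvx, hxc, h'⟩, h, hlt, hcM, hM⟩)
    · exact hxc'.ne' (congrArg p h)
    · rcases lt_trichotomy (p c') (p c) with h' | h' | h'
      · exact h45123 ![M', v, x, c', c] (mem_occurrences_45123.2
          ⟨⟨hMv, hvx, hxc', h'⟩, h, hlt', hcM, hM⟩)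
      · exact hne (hp h')
      · exact h45132 ![M', v, x, c, c'] (mem_occurrences_45132.2
          ⟨⟨hMv, hvx, hxc, h'⟩, h, hlt', hcM, hM⟩)
  exact ⟨(x, v), hcut.mem_repeats hcM (hlt.trans hcv) hvx, ev, ex, by rwa [eM, ec]⟩

/-- In each of these configurations the triple `v, b, c` is a 321 occurrence attached to no
repeat: a smaller letter lies to the right of `c`, or a letter smaller than `c` and one larger
than `b` lie between. -/
theorem not_isAttached_inl {m : ℕ} {p : Fin m → Fin m} {v b c : Fin m} {z : Fin m × Fin m}
    (h : (∃ d, d < c ∧ p c < p d) ∨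
      ∃ y M, y < c ∧ p b < p y ∧ p y < p c ∧ b < M ∧ M < v ∧ p M < p y) (hcv : c < v) :
    ¬ IsAttached p z (.inl ![v, b, c]) := by
  obtain ⟨x, v'⟩ := z
  rintro ⟨rfl : v = v', M', hcut : IsCut p v x M' c, h'⟩
  change (b = x ∧ c < x) ∨ (x < c ∧ b = M') at h'
  have hc := hcut.pos_right
  rcases h with ⟨d, hd, hcd⟩ | ⟨y, M, hy, hby, hyc, hM, hMv, hMy⟩
  · exact absurd (hcut.le_right d (hd.trans hcv) (hc.trans hcd)) hd.not_ge
  · have hyx : p y ≤ p x := not_lt.1 fun h => hy.not_ge (hcut.le_right y (hy.trans hcv) h)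
    rcases h' with ⟨rfl, -⟩ | ⟨-, rfl⟩
    · exact hby.not_ge hyx
    · exact hM.not_ge (hcut.le_left M hMv (hMy.le.trans hyx))

/-- A 3412 occurrence `M, v, x, c` is attached to no repeat if `M` can be increased or `c` can
be decreased. -/
theorem not_isAttached_inr {m : ℕ} {p : Fin m → Fin m} {M v x c : Fin m} {z : Fin m × Fin m}
    (h : (∃ M', M < M' ∧ M' < v ∧ p M' < p x) ∨ ∃ c', c' < c ∧ c' < v ∧ p x < p c') :
    ¬ IsAttached p z (.inr ![M, v, x, c]) := by
  obtain ⟨x', v'⟩ := z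
  rintro ⟨rfl : v = v', rfl : x = x', hcut : IsCut p v x M c⟩
  rcases h with ⟨M', hM, hv, hx⟩ | ⟨c', hc, hv, hx⟩
  · exact hM.not_ge (hcut.le_left M' hv hx.le)
  · exact hc.not_ge (hcut.le_right c' hv hx)

theorem exists_not_isAttached_of_not_avoidsPhi {m : ℕ} {w : Equiv.Perm (Fin m)}
    (h : ¬ AvoidsPhi w) :
    ∃ o ∈ (occurrences p321 ⇑w⁻¹).disjSum (occurrences p3412 ⇑w⁻¹),
      ∀ z, ¬ IsAttached ⇑w⁻¹ z o := by
  have triple : ∀ v b c : Fin m, c < b → b < v → w⁻¹ v < w⁻¹ b → w⁻¹ b < w⁻¹ c →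
      ((∃ d, d < c ∧ w⁻¹ c < w⁻¹ d) ∨
        ∃ y M, y < c ∧ w⁻¹ b < w⁻¹ y ∧ w⁻¹ y < w⁻¹ c ∧ b < M ∧ M < v ∧ w⁻¹ M < w⁻¹ y) →
      ∃ o ∈ (occurrences p321 ⇑w⁻¹).disjSum (occurrences p3412 ⇑w⁻¹),
        ∀ z, ¬ IsAttached ⇑w⁻¹ z o := fun v b c hcb hbv hvb hbc h =>
    ⟨.inl ![v, b, c], Finset.inl_mem_disjSum.2 (mem_occurrences_321.2 ⟨⟨hvb, hbc⟩, hcb, hbv⟩),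
      fun _ => not_isAttached_inl h (hcb.trans hbv)⟩
  have quadruple : ∀ M v x c : Fin m, x < c → c < M → M < v → w⁻¹ M < w⁻¹ v → w⁻¹ v < w⁻¹ x →
      w⁻¹ x < w⁻¹ c → ((∃ M', M < M' ∧ M' < v ∧ w⁻¹ M' < w⁻¹ x) ∨
        ∃ c', c' < c ∧ c' < v ∧ w⁻¹ x < w⁻¹ c') →
      ∃ o ∈ (occurrences p321 ⇑w⁻¹).disjSum (occurrences p3412 ⇑w⁻¹),
        ∀ z, ¬ IsAttached ⇑w⁻¹ z o := fun M v x c hxc hcM hMv h1 h2 h3 h =>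
    ⟨.inr ![M, v, x, c],
      Finset.inr_mem_disjSum.2 (mem_occurrences_3412.2 ⟨⟨h1, h2, h3⟩, hxc, hcM, hMv⟩),
      fun _ => not_isAttached_inr h⟩
  simp only [AvoidsPhi, forall_not_isOccSet_iff] at h
  by_contra hno
  refine h ⟨fun g hg => hno ?_, fun g hg => hno ?_, fun g hg => hno ?_, fun g hg => hno ?_,
    fun g hg => hno ?_, fun g hg => hno ?_, fun g hg => hno ?_, fun g hg => hno ?_,
    fun g hg => hno ?_, fun g hg => hno ?_⟩
  · obtain ⟨⟨p0, p1, p2⟩, v0, v1, v2⟩ := mem_occurrences_4321.1 hg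
    refine triple (g 0) (g 1) (g 2) ?_ ?_ ?_ ?_
      (.inl ⟨g 3, ?_, ?_⟩) <;>
    clear triple quadruple hno h hg <;> order
  · obtain ⟨⟨p0, p1, p2, p3⟩, v0, v1, v2, v3⟩ := mem_occurrences_34512.1 hg
    refine quadruple (g 0) (g 2) (g 3) (g 4) ?_ ?_ ?_ ?_ ?_ ?_
      (.inl ⟨g 1, ?_, ?_, ?_⟩) <;>
    clear triple quadruple hno h hg <;> order
  · obtain ⟨⟨p0, p1, p2, p3⟩, v0, v1, v2, v3⟩ := mem_occurrences_45123.1 hg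
    refine quadruple (g 0) (g 1) (g 2) (g 4) ?_ ?_ ?_ ?_ ?_ ?_
      (.inr ⟨g 3, ?_, ?_, ?_⟩) <;>
    clear triple quadruple hno h hg <;> order
  · obtain ⟨⟨p0, p1, p2, p3⟩, v0, v1, v2, v3⟩ := mem_occurrences_35412.1 hg
    refine quadruple (g 0) (g 1) (g 3) (g 4) ?_ ?_ ?_ ?_ ?_ ?_
      (.inl ⟨g 2, ?_, ?_, ?_⟩) <;>
    clear triple quadruple hno h hg <;> order
  · obtain ⟨⟨p0, p1, p2, p3⟩, v0, v1, v2, v3⟩ := mem_occurrences_43512.1 hg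
    refine quadruple (g 1) (g 2) (g 3) (g 4) ?_ ?_ ?_ ?_ ?_ ?_
      (.inl ⟨g 0, ?_, ?_, ?_⟩) <;>
    clear triple quadruple hno h hg <;> order
  · obtain ⟨⟨p0, p1, p2, p3⟩, v0, v1, v2, v3⟩ := mem_occurrences_45132.1 hg
    refine quadruple (g 0) (g 1) (g 2) (g 3) ?_ ?_ ?_ ?_ ?_ ?_
      (.inr ⟨g 4, ?_, ?_, ?_⟩) <;>
    clear triple quadruple hno h hg <;> order
  · obtain ⟨⟨p0, p1, p2, p3⟩, v0, v1, v2, v3⟩ := mem_occurrences_45213.1 hg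
    refine quadruple (g 0) (g 1) (g 2) (g 4) ?_ ?_ ?_ ?_ ?_ ?_
      (.inr ⟨g 3, ?_, ?_, ?_⟩) <;>
    clear triple quadruple hno h hg <;> order
  · obtain ⟨⟨p0, p1, p2, p3⟩, v0, v1, v2, v3⟩ := mem_occurrences_53412.1 hg
    refine triple (g 0) (g 1) (g 4) ?_ ?_ ?_ ?_
      (.inr ⟨g 3, g 2, ?_, ?_, ?_, ?_, ?_, ?_⟩) <;>
    clear triple quadruple hno h hg <;> order
  · obtain ⟨⟨p0, p1, p2, p3⟩, v0, v1, v2, v3⟩ := mem_occurrences_45312.1 hg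
    refine triple (g 1) (g 2) (g 4) ?_ ?_ ?_ ?_
      (.inr ⟨g 3, g 0, ?_, ?_, ?_, ?_, ?_, ?_⟩) <;>
    clear triple quadruple hno h hg <;> order
  · obtain ⟨⟨p0, p1, p2, p3⟩, v0, v1, v2, v3⟩ := mem_occurrences_45231.1 hg
    refine quadruple (g 0) (g 1) (g 2) (g 3) ?_ ?_ ?_ ?_ ?_ ?_
      (.inr ⟨g 4, ?_, ?_, ?_⟩) <;>
    clear triple quadruple hno h hg <;> order

theorem exists_isAttached_of_avoidsPhi {m : ℕ} {w : Equiv.Perm (Fin m)} (h : AvoidsPhi w)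
    {o : (Fin 3 → Fin m) ⊕ (Fin 4 → Fin m)}
    (ho : o ∈ (occurrences p321 ⇑w⁻¹).disjSum (occurrences p3412 ⇑w⁻¹)) :
    ∃ z ∈ repeats ⇑w⁻¹, IsAttached ⇑w⁻¹ z o := by
  simp only [AvoidsPhi, forall_not_isOccSet_iff] at h
  obtain ⟨h4321, h34512, h45123, h35412, h43512, h45132, h45213, h53412, h45312, h45231⟩ := h
  obtain g | g := o
  · exact exists_mem_repeats_isAttached_inl w⁻¹.injective h4321 h53412 h45312
      (Finset.inl_mem_disjSum.1 ho)
  · exact exists_mem_repeats_isAttached_inr w⁻¹.injective h34512 h45123 h35412 h43512 h45132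
      h45213 h45231 (Finset.inr_mem_disjSum.1 ho)

/-- main theorem: if `w` avoids every pattern in `Φ` then
`rep(w) = [321;3412](w)`, otherwise `rep(w) < [321;3412](w)`; in particular
`rep(w) ≤ [321;3412](w)` always. -/
theorem rep_vs_pattern_count {m : ℕ} (w : Equiv.Perm (Fin m)) :
    (AvoidsPhi w → rep w = occCount p321 w + occCount p3412 w) ∧
    (¬ AvoidsPhi w → rep w < occCount p321 w + occCount p3412 w) ∧
    rep w ≤ occCount p321 w + occCount p3412 w := by
  classical
  set R := repeats ⇑w⁻¹
  set T := (occurrences p321 ⇑w⁻¹).disjSum (occurrences p3412 ⇑w⁻¹) with hT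
  have hcard : occCount p321 w + occCount p3412 w = T.card := by
    rw [occCount_eq_card, occCount_eq_card, hT, Finset.card_disjSum]
  rw [rep_eq_card_repeats, hcard]
  have attach : ∀ z ∈ R, ∃ o ∈ T, IsAttached ⇑w⁻¹ z o := fun z hz =>
    exists_isAttached w⁻¹.injective hz
  have left_unique : ∀ o ∈ T, ({z ∈ R | IsAttached ⇑w⁻¹ z o} : Set _).Subsingleton :=
    fun o _ z hz z' hz' => hz.2.left_unique w⁻¹.injective hz.1 hz'.1 hz'.2
  have hle : R.card ≤ T.card :=
    Finset.card_le_card_of_forall_subsingleton _ attach left_unique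
  refine ⟨fun h => le_antisymm hle ?_, fun h => ?_, hle⟩
  · exact Finset.card_le_card_of_forall_subsingleton' _
      (fun o ho => exists_isAttached_of_avoidsPhi h ho)
      fun z _ o ho o' ho' => ho.2.right_unique ho.1 ho'.1 ho'.2
  · obtain ⟨o, ho, hno⟩ := exists_not_isAttached_of_not_avoidsPhi h
    refine (Finset.card_le_card_of_forall_subsingleton (t := T.erase o) _ (fun z hz => ?_)
      fun o' ho' => left_unique o' (Finset.mem_of_mem_erase ho')).trans_lt
      (Finset.card_erase_lt_of_mem ho)
    obtain ⟨o', ho', hz'⟩ := attach z hz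
    exact ⟨o', Finset.mem_erase.2 ⟨fun h => hno z (h ▸ hz'), ho'⟩, hz'⟩
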